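/- Let K, N be positive integers, θ_k > 0 and A_k > 0 for k ∈ {1,…,K}, and N₀, B, T_f, P_c, ϱ > 0. Then the effective energy efficiency η(P, Φ) = [ Σ_{k=1}^K Σ_{n=1}^N −(φ_{k,n}/θ_k)·ln( (N₀Bφ_{k,n}/p_{k,n})·e^{N₀Bφ_{k,n}/p_{k,n}}·E_{A_k}(N₀Bφ_{k,n}/p_{k,n}) ) ] / [ T_f·(P_c + ϱ·Σ_{k=1}^K Σ_{n=1}^N p_{k,n}) ] is quasiconcave, jointly in P = (p_{k,n}) and Φ = (φ_{k,n}), on the convex set where p_{k,n} > 0 and 0 < φ_{k,n} ≤ 1 for all k, n, where E_A(x) = ∫_1^∞ e^{−x t}·t^{−A} dt. -/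

import Mathlib

open MeasureTheory

/-- The generalized exponential integral `E_A(x) = ∫_1^∞ e^{−x·t}·t^{−A} dt`. -/
noncomputable def expInt (A x : ℝ) : ℝ :=
  ∫ t in Set.Ioi (1 : ℝ), Real.exp (-x * t) * t ^ (-A)

/-- The mean of `(1 + s·W)^{−A}` for a standard exponential random variable `W`. -/
noncomputable def expMean (A s : ℝ) : ℝ :=
  ∫ w in Set.Ioi (0 : ℝ), Real.exp (-w) * (1 + s * w) ^ (-A)

theorem integrableOn_expMean {A s : ℝ} (hA : 0 < A) (hs : 0 < s) :
    IntegrableOn (fun w : ℝ => Real.exp (-w) * (1 + s * w) ^ (-A)) (Set.Ioi 0) := by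
  refine Integrable.mono' (integrableOn_exp_neg_Ioi 0) (by fun_prop) ?_
  refine (ae_restrict_iff' measurableSet_Ioi).2 (Filter.Eventually.of_forall fun w hw => ?_)
  have h1 : 1 ≤ 1 + s * w := by
    have := mul_pos hs (Set.mem_Ioi.1 hw)
    linarith
  rw [Real.norm_of_nonneg (by positivity)]
  exact mul_le_of_le_one_right (Real.exp_pos _).le
    (Real.rpow_le_one_of_one_le_of_nonpos h1 (by linarith))

theorem expMean_pos {A s : ℝ} (hA : 0 < A) (hs : 0 < s) : 0 < expMean A s := by
  have hpos : ∀ w ∈ Set.Ioi (0 : ℝ), 0 < Real.exp (-w) * (1 + s * w) ^ (-A) := fun w hw => by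
    have := mul_pos hs (Set.mem_Ioi.1 hw)
    positivity
  rw [expMean, setIntegral_pos_iff_support_of_nonneg_ae
    ((ae_restrict_iff' measurableSet_Ioi).2 (Filter.Eventually.of_forall fun w hw => (hpos w hw).le))
    (integrableOn_expMean hA hs), Set.inter_eq_right.2
    fun w hw => Function.mem_support.2 (hpos w hw).ne']
  simp

theorem mul_exp_mul_expInt {A x : ℝ} (hx : 0 < x) :
    x * Real.exp x * expInt A x = expMean A x⁻¹ := by
  have hshift : expInt A x =
      ∫ v in Set.Ioi (0 : ℝ), Real.exp (-x * (v + 1)) * (v + 1) ^ (-A) := by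
    have h := (measurePreserving_add_right volume (1 : ℝ)).setIntegral_preimage_emb
      (measurableEmbedding_addRight 1) (fun t : ℝ => Real.exp (-x * t) * t ^ (-A)) (Set.Ioi 1)
    simpa [expInt] using h.symm
  have hscale := integral_comp_mul_left_Ioi'
    (fun w : ℝ => Real.exp (-w) * (1 + x⁻¹ * w) ^ (-A)) 0 hx
  rw [mul_zero] at hscale
  rw [expMean, ← hscale, hshift, smul_eq_mul, mul_assoc, ← integral_const_mul]
  congr 2
  ext v
  rw [← mul_assoc, ← Real.exp_add, inv_mul_cancel_left₀ hx.ne', add_comm v 1]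
  ring_nf

/-- Weighted AM–GM makes the integrand of `expMean` log-convex in `s`. -/
theorem exp_mul_rpow_log_convex {A s t a b w : ℝ} (hA : 0 < A) (hs : 0 < s) (ht : 0 < t)
    (ha : 0 ≤ a) (hb : 0 ≤ b) (hab : a + b = 1) (hw : 0 < w) :
    Real.exp (-w) * (1 + (a * s + b * t) * w) ^ (-A) ≤
      (Real.exp (-w) * (1 + s * w) ^ (-A)) ^ a * (Real.exp (-w) * (1 + t * w) ^ (-A)) ^ b := by
  have hs1 : 0 < 1 + s * w := by positivity
  have ht1 : 0 < 1 + t * w := by positivity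
  have amgm := Real.geom_mean_le_arith_mean2_weighted ha hb hs1.le ht1.le hab
  have hsum : a * (1 + s * w) + b * (1 + t * w) = 1 + (a * s + b * t) * w := by
    linear_combination hab
  rw [hsum] at amgm
  have hexp : Real.exp (-w) = Real.exp (-w) ^ a * Real.exp (-w) ^ b := by
    rw [← Real.rpow_add (Real.exp_pos _), hab, Real.rpow_one]
  calc Real.exp (-w) * (1 + (a * s + b * t) * w) ^ (-A)
      ≤ Real.exp (-w) * ((1 + s * w) ^ a * (1 + t * w) ^ b) ^ (-A) := by
        gcongr ?_ * ?_
        exact Real.rpow_le_rpow_of_nonpos (by positivity) amgm (by linarith)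
    _ = (Real.exp (-w) ^ a * Real.exp (-w) ^ b) *
          (((1 + s * w) ^ (-A)) ^ a * ((1 + t * w) ^ (-A)) ^ b) := by
        rw [← hexp, Real.mul_rpow (by positivity) (by positivity), ← Real.rpow_mul hs1.le,
          ← Real.rpow_mul ht1.le, ← Real.rpow_mul hs1.le, ← Real.rpow_mul ht1.le,
          mul_comm a, mul_comm b]
    _ = _ := by
        rw [Real.mul_rpow (by positivity) (by positivity),
          Real.mul_rpow (by positivity) (by positivity)]
        ring

theorem expMean_le_rpow_mul_rpow {A s t a b : ℝ} (hA : 0 < A) (hs : 0 < s) (ht : 0 < t)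
    (ha : 0 ≤ a) (hb : 0 ≤ b) (hab : a + b = 1) :
    expMean A (a * s + b * t) ≤ expMean A s ^ a * expMean A t ^ b := by
  have hF := expMean_pos hA hs
  have hG := expMean_pos hA ht
  have hst : 0 < a * s + b * t := (convex_Ioi (0 : ℝ)) hs ht ha hb hab
  set C := expMean A s ^ a * expMean A t ^ b with hC
  have hCpos : 0 < C := by positivity
  have his := (integrableOn_expMean hA hs).const_mul (C * (a / expMean A s))
  have hit := (integrableOn_expMean hA ht).const_mul (C * (b / expMean A t))
  have hle : expMean A (a * s + b * t) ≤ ∫ w in Set.Ioi (0 : ℝ),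
      (C * (a / expMean A s) * (Real.exp (-w) * (1 + s * w) ^ (-A)) +
        C * (b / expMean A t) * (Real.exp (-w) * (1 + t * w) ^ (-A))) := by
    refine setIntegral_mono_on (integrableOn_expMean hA hst) (his.add hit) measurableSet_Ioi
      fun w hw => ?_
    have hw' : 0 < w := hw
    refine (exp_mul_rpow_log_convex hA hs ht ha hb hab hw').trans ?_
    set f := Real.exp (-w) * (1 + s * w) ^ (-A)
    set g := Real.exp (-w) * (1 + t * w) ^ (-A)
    have hf : 0 ≤ f := by positivity
    have hg : 0 ≤ g := by positivity
    have amgm := Real.geom_mean_le_arith_mean2_weighted ha hb (div_nonneg hf hF.le)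
      (div_nonneg hg hG.le) hab
    rw [Real.div_rpow hf hF.le, Real.div_rpow hg hG.le, div_mul_div_comm, ← hC,
      div_le_iff₀ hCpos] at amgm
    refine amgm.trans_eq ?_
    ring
  refine hle.trans_eq ?_
  rw [integral_add his hit, integral_const_mul, integral_const_mul]
  change C * (a / expMean A s) * expMean A s + C * (b / expMean A t) * expMean A t = C
  field_simp
  linear_combination hab

theorem convexOn_log_expMean {A : ℝ} (hA : 0 < A) :
    ConvexOn ℝ (Set.Ioi 0) fun s => Real.log (expMean A s) := by
  refine ⟨convex_Ioi 0, fun s hs t ht a b ha hb hab => ?_⟩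
  have hF := expMean_pos hA hs
  have hG := expMean_pos hA ht
  have hst : 0 < a * s + b * t := (convex_Ioi (0 : ℝ)) hs ht ha hb hab
  have h := Real.log_le_log (expMean_pos hA hst) (expMean_le_rpow_mul_rpow hA hs ht ha hb hab)
  rwa [Real.log_mul (by positivity) (by positivity), Real.log_rpow hF, Real.log_rpow hG] at h

/-- The perspective of a convex function on the positive half-line is jointly convex. -/
theorem ConvexOn.perspective_le {f : ℝ → ℝ} (hf : ConvexOn ℝ (Set.Ioi 0) f)
    {p₁ p₂ u₁ u₂ a b : ℝ} (hp₁ : 0 < p₁) (hp₂ : 0 < p₂) (hu₁ : 0 < u₁) (hu₂ : 0 < u₂)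
    (ha : 0 ≤ a) (hb : 0 ≤ b) (hab : a + b = 1) :
    (a * u₁ + b * u₂) * f ((a * p₁ + b * p₂) / (a * u₁ + b * u₂)) ≤
      a * (u₁ * f (p₁ / u₁)) + b * (u₂ * f (p₂ / u₂)) := by
  have hu : 0 < a * u₁ + b * u₂ := (convex_Ioi (0 : ℝ)) hu₁ hu₂ ha hb hab
  have h := hf.2 (Set.mem_Ioi.2 (div_pos hp₁ hu₁)) (Set.mem_Ioi.2 (div_pos hp₂ hu₂))
    (div_nonneg (mul_nonneg ha hu₁.le) hu.le) (div_nonneg (mul_nonneg hb hu₂.le) hu.le)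
    (by rw [← add_div, div_self hu.ne'])
  simp only [smul_eq_mul] at h
  have harg : a * u₁ / (a * u₁ + b * u₂) * (p₁ / u₁) + b * u₂ / (a * u₁ + b * u₂) * (p₂ / u₂) =
      (a * p₁ + b * p₂) / (a * u₁ + b * u₂) := by
    field_simp
  rw [harg] at h
  refine (mul_le_mul_of_nonneg_left h hu.le).trans_eq ?_
  field_simp

/-- Joint concavity of the effective capacity of a single user on a single subcarrier. -/
theorem effectiveCapacity_concave {A θ c p₁ p₂ u₁ u₂ a b : ℝ} (hA : 0 < A) (hθ : 0 < θ)
    (hc : 0 < c) (hp₁ : 0 < p₁) (hp₂ : 0 < p₂) (hu₁ : 0 < u₁) (hu₂ : 0 < u₂)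
    (ha : 0 ≤ a) (hb : 0 ≤ b) (hab : a + b = 1) :
    let g := fun p u : ℝ => -(u / θ) *
      Real.log ((c * u / p) * Real.exp (c * u / p) * expInt A (c * u / p))
    a * g p₁ u₁ + b * g p₂ u₂ ≤ g (a * p₁ + b * p₂) (a * u₁ + b * u₂) := by
  intro g
  have hg : ∀ p u : ℝ, 0 < p → 0 < u →
      g p u = -(u * Real.log (expMean A ((p / c) / u))) / θ := fun p u hp hu => by
    simp only [g]
    rw [mul_exp_mul_expInt (by positivity), inv_div, div_div]
    ring
  have h := (convexOn_log_expMean hA).perspective_le (div_pos hp₁ hc) (div_pos hp₂ hc) hu₁ hu₂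
    ha hb hab
  have hp : a * (p₁ / c) + b * (p₂ / c) = (a * p₁ + b * p₂) / c := by ring
  rw [hp] at h
  rw [hg _ _ hp₁ hu₁, hg _ _ hp₂ hu₂,
    hg (a * p₁ + b * p₂) (a * u₁ + b * u₂) ((convex_Ioi (0 : ℝ)) hp₁ hp₂ ha hb hab)
      ((convex_Ioi (0 : ℝ)) hu₁ hu₂ ha hb hab),
    mul_div_assoc', mul_div_assoc', ← add_div, div_le_div_iff_of_pos_right hθ]
  linarith

/-- The effective energy efficiency of the downlink OFDMA system —
the ratio of the time-sharing-relaxed system effective capacity to the total consumed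
energy `T_f·(P_c + ϱ·Σ_{k,n} p_{k,n})` — is jointly quasiconcave in `(P, Φ)` on the convex
set where `p_{k,n} > 0` and `0 < φ_{k,n} ≤ 1`: every superlevel set is convex (Lemma 2). -/
theorem stmt_12 (K N : ℕ) (hK : 0 < K) (hN : 0 < N)
    (θ A : Fin K → ℝ) (hθ : ∀ k, 0 < θ k) (hA : ∀ k, 0 < A k)
    (N₀ B Tf Pc ϱ : ℝ) (hN₀ : 0 < N₀) (hB : 0 < B) (hTf : 0 < Tf) (hPc : 0 < Pc)
    (hϱ : 0 < ϱ)
    (η : (Fin K → Fin N → ℝ) × (Fin K → Fin N → ℝ) → ℝ)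
    (hη : ∀ q, η q =
      (∑ k, ∑ n, -(q.2 k n / θ k) * Real.log ((N₀ * B * q.2 k n / q.1 k n) *
          Real.exp (N₀ * B * q.2 k n / q.1 k n) *
          expInt (A k) (N₀ * B * q.2 k n / q.1 k n))) /
        (Tf * (Pc + ϱ * ∑ k, ∑ n, q.1 k n))) :
    ∀ α : ℝ, Convex ℝ
      {q : (Fin K → Fin N → ℝ) × (Fin K → Fin N → ℝ) |
        (∀ k n, 0 < q.1 k n ∧ 0 < q.2 k n ∧ q.2 k n ≤ 1) ∧ α ≤ η q} := by
  rintro α q ⟨hq, hqα⟩ r ⟨hr, hrα⟩ a b ha hb hab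
  have hmem : ∀ k n, 0 < (a • q + b • r).1 k n ∧ 0 < (a • q + b • r).2 k n ∧
      (a • q + b • r).2 k n ≤ 1 := fun k n =>
    ⟨(convex_Ioi (0 : ℝ)) (hq k n).1 (hr k n).1 ha hb hab,
      (convex_Ioc (0 : ℝ) 1) (hq k n).2 (hr k n).2 ha hb hab⟩
  have hden : ∀ q : (Fin K → Fin N → ℝ) × (Fin K → Fin N → ℝ),
      (∀ k n, 0 < q.1 k n ∧ 0 < q.2 k n ∧ q.2 k n ≤ 1) →
      0 < Tf * (Pc + ϱ * ∑ k, ∑ n, q.1 k n) := fun q hq => by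
    have : 0 ≤ ∑ k, ∑ n, q.1 k n :=
      Finset.sum_nonneg fun k _ => Finset.sum_nonneg fun n _ => (hq k n).1.le
    positivity
  refine ⟨hmem, ?_⟩
  rw [hη, le_div_iff₀ (hden _ ‹_›)] at hqα hrα ⊢
  have hpower : ∑ k, ∑ n, (a • q + b • r).1 k n =
      a * ∑ k, ∑ n, q.1 k n + b * ∑ k, ∑ n, r.1 k n := by
    simp [Finset.sum_add_distrib, Finset.mul_sum]
  have hcap := Finset.sum_le_sum fun k (_ : k ∈ Finset.univ) =>
    Finset.sum_le_sum fun n (_ : n ∈ Finset.univ) =>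
      effectiveCapacity_concave (hA k) (hθ k) (mul_pos hN₀ hB) (hq k n).1 (hr k n).1
        (hq k n).2.1 (hr k n).2.1 ha hb hab
  simp only [Finset.sum_add_distrib, ← Finset.mul_sum] at hcap
  refine le_trans ?_ hcap
  rw [hpower]
  have hb' : b = 1 - a := by linarith
  calc _ = a * (α * (Tf * (Pc + ϱ * ∑ k, ∑ n, q.1 k n))) +
        b * (α * (Tf * (Pc + ϱ * ∑ k, ∑ n, r.1 k n))) := by
        rw [hb']
        ring
    _ ≤ _ := add_le_add (mul_le_mul_of_nonneg_left hqα ha) (mul_le_mul_of_nonneg_left hrα hb)
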